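/- Let (V, ≤) be a finite partially ordered set and k a positive integer. If a finite family 𝒜 of pairwise disjoint antichains minimizes |V ∖ ⋃𝒜| + k·|𝒜| over all finite families of pairwise disjoint antichains, then its partition completion 𝒜^V is an antichain partition of minimum k-norm; in particular Σ_{A ∈ 𝒜^V} min(|A|, k) equals the maximum cardinality β_k of the union of k pairwise disjoint chains of V. -/

import Mathlib

/-- **Egerváry's theorem**: for integer costs `c` on the edges of a bipartite graph `r` having the
identity as a perfect matching, there are integer potentials and a perfect matching all of whose
edges are tight. -/
theorem exists_potentials_perm_tight {L : Type*} [Fintype L] [DecidableEq L]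
    (r : L → L → Prop) (hr : ∀ a, r a a) (c : L → L → ℤ) :
    ∃ (p q : L → ℤ) (σ : Equiv.Perm L), (∀ a b, r a b → p a + q b ≤ c a b) ∧
      ∀ a, r a (σ a) ∧ p a + q (σ a) = c a (σ a) := by
  classical
  obtain ⟨M, ⟨p, q, hpq, hM⟩, hmax⟩ := Int.exists_greatest_of_bdd
    (P := fun z => ∃ p q : L → ℤ, (∀ a b, r a b → p a + q b ≤ c a b) ∧
      ∑ a, p a + ∑ a, q a = z)
    ⟨∑ a, c a a, by
      rintro z ⟨p, q, h, rfl⟩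
      rw [← Finset.sum_add_distrib]
      exact Finset.sum_le_sum fun a _ => h a a (hr a)⟩
    ⟨_, fun a => -∑ b, |c a b|, 0, fun a b _ => by
      have h1 : |c a b| ≤ ∑ b, |c a b| :=
        Finset.single_le_sum (f := fun b => |c a b|) (fun _ _ => abs_nonneg _) (Finset.mem_univ b)
      have h2 := neg_abs_le (c a b)
      simp only [Pi.zero_apply]
      linarith, rfl⟩
  have hall : ∀ S : Finset L,
      S.card ≤ (Finset.univ.filter
        fun b => ∃ a ∈ S, r a b ∧ p a + q b = c a b).card := by
    intro S
    set N := Finset.univ.filter fun b => ∃ a ∈ S, r a b ∧ p a + q b = c a b with hN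
    have := hmax _ ⟨fun a => p a + if a ∈ S then 1 else 0,
      fun b => q b - if b ∈ N then 1 else 0, fun a b hab => by
        have h := hpq a b hab
        have h' : a ∈ S → b ∉ N → p a + q b ≠ c a b := fun ha hb he =>
          hb (by simp only [hN, Finset.mem_filter_univ]; exact ⟨a, ha, hab, he⟩)
        by_cases ha : a ∈ S <;> by_cases hb : b ∈ N <;> simp only [ha, hb, if_true, if_false]
        · lia
        · have := h' ha hb
          lia
        · lia
        · lia, rfl⟩
    simp only [Finset.sum_add_distrib, Finset.sum_sub_distrib, Finset.sum_boole,
      Finset.filter_univ_mem] at this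
    lia
  obtain ⟨f, hf, hfr⟩ := (Fintype.all_card_le_filter_rel_iff_exists_injective
    (fun a b => r a b ∧ p a + q b = c a b)).1 hall
  exact ⟨p, q, Equiv.ofBijective f (Finite.injective_iff_bijective.1 hf), hpq, hfr⟩

/-- A permutation of `V ⊕ ι` that is nondecreasing on `V` decomposes the non-fixed elements
of `V` into disjoint chains indexed by `ι`. -/
theorem exists_chains_of_perm {V ι : Type*} [Fintype V] [PartialOrder V]
    (σ : Equiv.Perm (V ⊕ ι)) (hσ : ∀ u v, σ (.inl u) = .inl v → u ≤ v) :
    ∃ C : ι → Finset V, (∀ i, IsChain (· ≤ ·) (C i : Set V)) ∧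
      (∀ i j, i ≠ j → Disjoint (C i) (C j)) ∧
      ∀ v, σ (.inl v) ≠ .inl v → ∃ i, v ∈ C i := by
  classical
  let step : V → V → Prop := fun u v => σ (.inl u) = .inl v
  have hle : ∀ {u v}, Relation.ReflTransGen step u v → u ≤ v := by
    intro u v h
    induction h with
    | refl => exact le_rfl
    | tail _ h ih => exact ih.trans (hσ _ _ h)
  have hru : Relator.RightUnique step := fun a b c hb hc =>
    Sum.inl_injective (hb.symm.trans hc)
  have hlu : Relator.RightUnique (Function.swap step) := fun a b c hb hc =>
    Sum.inl_injective (σ.injective (Eq.trans hb (Eq.symm hc)))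
  have hstart : ∀ {i u v}, σ (.inr i) = .inl v → Relation.ReflTransGen step u v → u = v := by
    intro i u v hi h
    rcases h.cases_tail with h | ⟨w, -, hw⟩
    · exact h.symm
    · exact absurd (σ.injective (hi.trans hw.symm)) (by simp)
  refine ⟨fun i => Finset.univ.filter fun v =>
    ∃ w, σ (.inr i) = .inl w ∧ Relation.ReflTransGen step w v, ?_, ?_, ?_⟩
  · intro i u hu v hv _
    simp only [Finset.coe_filter, Finset.mem_univ, true_and, Set.mem_ofPred_eq] at hu hv
    obtain ⟨w, hw, hwu⟩ := hu
    obtain ⟨w', hw', hwv⟩ := hv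
    obtain rfl : w = w' := Sum.inl_injective (hw.symm.trans hw')
    exact (Relation.ReflTransGen.total_of_right_unique hru hwu hwv).imp hle hle
  · intro i j hij
    rw [Finset.disjoint_left]
    intro v hu hv
    simp only [Finset.mem_filter_univ] at hu hv
    obtain ⟨w, hw, hwu⟩ := hu
    obtain ⟨w', hw', hwv⟩ := hv
    have hww : w = w' := by
      rcases Relation.ReflTransGen.total_of_right_unique hlu
        (Relation.reflTransGen_swap.2 hwu) (Relation.reflTransGen_swap.2 hwv) with h | h
      · exact (hstart hw (Relation.reflTransGen_swap.1 h)).symm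
      · exact hstart hw' (Relation.reflTransGen_swap.1 h)
    subst hww
    exact hij (Sum.inr_injective (σ.injective (hw.trans hw'.symm)))
  · intro v
    induction v using WellFoundedLT.induction with
    | ind v ih =>
      intro hv
      simp only [Finset.mem_filter_univ] at ih ⊢
      obtain ⟨x, hx⟩ := σ.surjective (.inl v)
      rcases x with u | i
      · have huv : u ≠ v := by
          rintro rfl
          exact hv hx
        obtain ⟨i, w, hw, hwu⟩ := ih u (lt_of_le_of_ne (hσ _ _ hx) huv) (by
          rw [hx]
          exact fun h => huv (Sum.inl_injective h).symm)
        exact ⟨i, w, hw, hwu.tail hx⟩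
      · exact ⟨i, v, hx, .refl⟩

/-- The hard direction of **Greene's theorem** on unions of `k` chains. -/
theorem exists_chains_antichains_card_le {V : Type*} [Fintype V] [DecidableEq V]
    [PartialOrder V] {k : ℕ} (hk : 0 < k) :
    ∃ (C : Fin k → Finset V) (m : ℕ) (A : Fin m → Finset V),
      (∀ i, IsChain (· ≤ ·) (C i : Set V)) ∧
      (∀ i j, i ≠ j → Disjoint (C i) (C j)) ∧
      (∀ i, IsAntichain (· ≤ ·) (A i : Set V)) ∧
      (∀ i j, i ≠ j → Disjoint (A i) (A j)) ∧
      (Finset.univ \ Finset.univ.biUnion A).card + k * m ≤ (Finset.univ.biUnion C).card := by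
  classical
  have : Nonempty (Fin k) := ⟨⟨0, hk⟩⟩
  obtain ⟨p, q, σ, hpq, hσ⟩ := exists_potentials_perm_tight (L := V ⊕ Fin k)
    (fun a b => ∀ u v, a = .inl u → b = .inl v → u ≤ v)
    (fun a u v hu hv => (Sum.inl_injective (hu.symm.trans hv)).le)
    (fun a b => if a = b ∧ a.isLeft then 1 else 0)
  obtain ⟨C, hC, hCd, hcov⟩ := exists_chains_of_perm σ fun u v h => (hσ _).1 u v rfl h
  obtain ⟨s, hs⟩ := Finite.exists_max fun i => p (.inr i)
  obtain ⟨t, ht⟩ := Finite.exists_max fun i => q (.inr i)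
  have hst : p (.inr s) + q (.inr t) ≤ 0 := by
    simpa using hpq (.inr s) (.inr t) (by simp)
  have hsv : ∀ v, p (.inr s) + q (.inl v) ≤ 0 := fun v => by
    simpa using hpq (.inr s) (.inl v) (by simp)
  have hvt : ∀ v, p (.inl v) + q (.inr t) ≤ 0 := fun v => by
    simpa using hpq (.inl v) (.inr t) (by simp)
  have hvv : ∀ v, p (.inl v) + q (.inl v) ≤ 1 := fun v => by
    simpa using hpq (.inl v) (.inl v) (by simp)
  have hlt : ∀ u v, u ≤ v → u ≠ v → p (.inl u) + q (.inl v) ≤ 0 := fun u v huv hne => by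
    simpa [hne] using hpq (.inl u) (.inl v) (by simpa using huv)
  let m := (-(p (.inr s) + q (.inr t))).toNat
  have hm : (m : ℤ) = -(p (.inr s) + q (.inr t)) := Int.toNat_of_nonneg (by lia)
  let A : Fin m → Finset V := fun i => Finset.univ.filter fun v =>
    p (.inl v) + q (.inl v) = 1 ∧ p (.inl v) = p (.inr s) + 1 + (i : ℕ)
  have hAU : Finset.univ.biUnion A =
      Finset.univ.filter fun v => p (.inl v) + q (.inl v) = 1 := by
    ext v
    simp only [A, Finset.mem_biUnion, Finset.mem_filter_univ, Finset.mem_univ, true_and]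
    constructor
    · rintro ⟨i, h, -⟩
      exact h
    · intro h
      have h1 := hsv v
      have h2 := hvt v
      refine ⟨⟨(p (.inl v) - p (.inr s) - 1).toNat, by lia⟩, h, ?_⟩
      simp only
      lia
  refine ⟨C, m, A, hC, hCd, ?_, ?_, ?_⟩
  · intro i u hu v hv hne huv
    simp only [A, Finset.coe_filter, Finset.mem_univ, true_and, Set.mem_ofPred_eq] at hu hv
    have := hlt u v huv hne
    lia
  · intro i j hij
    rw [Finset.disjoint_left]
    intro v hu hv
    simp only [A, Finset.mem_filter_univ] at hu hv
    exact hij (Fin.ext (by lia))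
  · have hnonfix : (Finset.univ.filter fun v => ¬ σ (.inl v) = .inl v).card ≤
        (Finset.univ.biUnion C).card :=
      Finset.card_le_card fun v hv => by
        simpa using hcov v (by simpa using hv)
    have hfix := Finset.card_filter_add_card_filter_not (s := (Finset.univ : Finset V))
      (fun v => σ (.inl v) = .inl v)
    have hunc : (Finset.univ \ Finset.univ.biUnion A).card + (Finset.univ.biUnion A).card =
        (Finset.univ : Finset V).card :=
      Finset.card_sdiff_add_card_eq_card (Finset.subset_univ _)
    have hdual : ∑ a, p a + ∑ a, q a =
        (Finset.univ.filter fun v => σ (.inl v) = .inl v).card := by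
      rw [← Equiv.sum_comp σ q, ← Finset.sum_add_distrib,
        Finset.sum_congr rfl fun a _ => (hσ a).2, Fintype.sum_sum_type]
      simp [eq_comm]
    have hV : ∑ v : V, (p (.inl v) + q (.inl v)) ≤ (Finset.univ.biUnion A).card := by
      rw [hAU, ← Finset.sum_boole]
      refine Finset.sum_le_sum fun v _ => ?_
      have := hvv v
      split_ifs <;> lia
    have hp : ∑ i, p (.inr i) ≤ k * p (.inr s) := by
      simpa using Finset.sum_le_card_nsmul Finset.univ (fun i => p (.inr i)) _ fun i _ => hs i
    have hq : ∑ i, q (.inr i) ≤ k * q (.inr t) := by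
      simpa using Finset.sum_le_card_nsmul Finset.univ (fun i => q (.inr i)) _ fun i _ => ht i
    rw [Fintype.sum_sum_type, Fintype.sum_sum_type] at hdual
    rw [Finset.sum_add_distrib] at hV
    have hkm : (k : ℤ) * m = -(k * p (.inr s) + k * q (.inr t)) := by
      rw [hm]
      ring
    zify at *
    linarith

/-- Weak duality between unions of chains and families of antichains. -/
theorem card_biUnion_chains_le {V : Type*} [Fintype V] [DecidableEq V] [PartialOrder V]
    {k m : ℕ} (C : Fin k → Finset V) (A : Fin m → Finset V)
    (hC : ∀ i, IsChain (· ≤ ·) (C i : Set V)) (hA : ∀ i, IsAntichain (· ≤ ·) (A i : Set V)) :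
    (Finset.univ.biUnion C).card ≤ (Finset.univ \ Finset.univ.biUnion A).card + k * m := by
  have hsub : Finset.univ.biUnion C ⊆ (Finset.univ \ Finset.univ.biUnion A) ∪
      (Finset.univ : Finset (Fin k × Fin m)).biUnion fun x => C x.1 ∩ A x.2 := by
    intro v hv
    simp only [Finset.mem_biUnion, Finset.mem_univ, true_and, Finset.mem_union,
      Finset.mem_sdiff, Finset.mem_inter, Prod.exists] at hv ⊢
    obtain ⟨i, hi⟩ := hv
    by_cases h : ∃ j, v ∈ A j
    · exact .inr ⟨i, h.choose, hi, h.choose_spec⟩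
    · exact .inl h
  refine (Finset.card_le_card hsub).trans ((Finset.card_union_le _ _).trans ?_)
  gcongr
  refine (Finset.card_biUnion_le_card_mul _ _ 1 fun x _ => ?_).trans (by simp)
  refine Finset.card_le_one.2 fun u hu v hv => ?_
  simp only [Finset.mem_inter] at hu hv
  by_contra hne
  rcases hC x.1 hu.1 hv.1 hne with h | h
  · exact hA x.2 hu.2 hv.2 hne h
  · exact hA x.2 hv.2 hu.2 (Ne.symm hne) h

/-- The antichains of size at least `k` in an antichain partition form a family whose `k`-norm
is that of the partition. -/
theorem exists_family_norm_eq_sum_min {V : Type*} [Fintype V] [DecidableEq V] [PartialOrder V]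
    (k : ℕ) {n : ℕ} (B : Fin n → Finset V) (hB : ∀ i, IsAntichain (· ≤ ·) (B i : Set V))
    (hd : ∀ i j, i ≠ j → Disjoint (B i) (B j)) (hU : Finset.univ.biUnion B = Finset.univ) :
    ∃ (m : ℕ) (A : Fin m → Finset V), (∀ i, IsAntichain (· ≤ ·) (A i : Set V)) ∧
      (∀ i j, i ≠ j → Disjoint (A i) (A j)) ∧
      (Finset.univ \ Finset.univ.biUnion A).card + k * m = ∑ i, min (B i).card k := by
  classical
  let T : Finset (Fin n) := Finset.univ.filter fun i => k ≤ (B i).card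
  let e : Fin T.card ≃ T := T.equivFin.symm
  refine ⟨T.card, fun i => B (e i), fun i => hB _, fun i j hij => hd _ _ fun h => hij
    (e.injective (Subtype.ext h)), ?_⟩
  have hunc : Finset.univ \ Finset.univ.biUnion (fun i => B (e i)) = Tᶜ.biUnion B := by
    have hTB : Finset.univ.biUnion (fun i => B (e i)) = T.biUnion B := by
      ext v
      simp only [Finset.mem_biUnion, Finset.mem_univ, true_and]
      constructor
      · rintro ⟨i, hi⟩
        exact ⟨_, (e i).2, hi⟩
      · rintro ⟨i, hi, hv⟩
        exact ⟨e.symm ⟨i, hi⟩, by simpa using hv⟩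
    rw [hTB]
    ext v
    have hv : v ∈ Finset.univ.biUnion B := hU ▸ Finset.mem_univ v
    simp only [Finset.mem_biUnion, Finset.mem_univ, true_and, Finset.mem_sdiff,
      Finset.mem_compl] at hv ⊢
    obtain ⟨i, hi⟩ := hv
    constructor
    · exact fun h => ⟨i, fun hT => h ⟨i, hT, hi⟩, hi⟩
    · rintro ⟨j, hj, hvj⟩ ⟨l, hl, hvl⟩
      exact Finset.disjoint_left.1 (hd j l fun h => hj (h ▸ hl)) hvj hvl
  rw [hunc, Finset.card_biUnion fun i _ j _ hij => hd i j hij, ← Finset.sum_compl_add_sum T]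
  congr 1
  · refine Finset.sum_congr rfl fun i hi => ?_
    simp only [T, Finset.mem_compl, Finset.mem_filter_univ] at hi
    lia
  · rw [Finset.sum_congr rfl fun i hi => min_eq_right (Finset.mem_filter.1 hi).2]
    rw [Finset.sum_const, smul_eq_mul, mul_comm]

/-- Every member of a family of disjoint antichains of minimum `k`-norm has at least `k`
elements. -/
theorem le_card_of_minimal_family {V : Type*} [Fintype V] [DecidableEq V] [PartialOrder V]
    {k m : ℕ} (A : Fin m → Finset V) (hA : ∀ i, IsAntichain (· ≤ ·) (A i : Set V))
    (hd : ∀ i j, i ≠ j → Disjoint (A i) (A j))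
    (hmin : ∀ (m' : ℕ) (A' : Fin m' → Finset V),
      (∀ i, IsAntichain (· ≤ ·) (A' i : Set V)) →
      (∀ i j, i ≠ j → Disjoint (A' i) (A' j)) →
      (Finset.univ \ Finset.univ.biUnion A).card + k * m ≤
        (Finset.univ \ Finset.univ.biUnion A').card + k * m') (i : Fin m) :
    k ≤ (A i).card := by
  obtain _ | m := m
  · exact i.elim0
  have h := hmin m (fun j => A (i.succAbove j)) (fun _ => hA _) fun j l hjl =>
    hd _ _ (Fin.succAbove_right_injective.ne hjl)
  have hsub : Finset.univ \ Finset.univ.biUnion (fun j => A (i.succAbove j)) ⊆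
      (Finset.univ \ Finset.univ.biUnion A) ∪ A i := by
    intro v
    simp only [Finset.mem_biUnion, Finset.mem_univ, true_and, Finset.mem_sdiff,
      Finset.mem_union, i.exists_iff_succAbove (P := fun j => v ∈ A j)]
    tauto
  have hcard := (Finset.card_le_card hsub).trans (Finset.card_union_le _ _)
  rw [mul_add] at h
  lia

/-- If a family `A` of pairwise disjoint antichains (indexed by `Fin m`) of a finite
poset `V` minimizes the `k`-norm `|V \ ⋃ A| + k * |A|` over all finite families of
pairwise disjoint antichains, then its partition completion `A^V` (the antichains of `A`
together with singletons for the uncovered elements) is an antichain partition of `V` of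
minimum `k`-norm; in particular its `k`-norm equals the maximum cardinality `β_k` of the
union of `k` pairwise disjoint chains of `V`. -/
theorem min_antichain_family_completion (V : Type) [Fintype V] [DecidableEq V]
    [PartialOrder V] (k : ℕ) (hk : 0 < k) (m : ℕ)
    (A : Fin m → Finset V)
    (hA : ∀ i, IsAntichain (· ≤ ·) ((A i : Finset V) : Set V))
    (hAdisj : ∀ i j, i ≠ j → Disjoint (A i) (A j))
    (hmin : ∀ (m' : ℕ) (A' : Fin m' → Finset V),
      (∀ i, IsAntichain (· ≤ ·) ((A' i : Finset V) : Set V)) →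
      (∀ i j, i ≠ j → Disjoint (A' i) (A' j)) →
      (Finset.univ \ Finset.univ.biUnion A).card + k * m ≤
        (Finset.univ \ Finset.univ.biUnion A').card + k * m') :
    (∀ D ∈ (Finset.univ.image A ∪
        (Finset.univ \ Finset.univ.biUnion A).image (fun v => ({v} : Finset V))),
      IsAntichain (· ≤ ·) ((D : Finset V) : Set V) ∧ D.Nonempty) ∧
    ((↑(Finset.univ.image A ∪
        (Finset.univ \ Finset.univ.biUnion A).image (fun v => ({v} : Finset V))) :
        Set (Finset V)).Pairwise fun D E => Disjoint D E) ∧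
    (Finset.univ.image A ∪
        (Finset.univ \ Finset.univ.biUnion A).image
          (fun v => ({v} : Finset V))).biUnion id = Finset.univ ∧
    (∑ D ∈ (Finset.univ.image A ∪
        (Finset.univ \ Finset.univ.biUnion A).image (fun v => ({v} : Finset V))),
      min D.card k) =
      sInf {n : ℕ | ∃ (m' : ℕ) (B : Fin m' → Finset V),
        (∀ i, IsAntichain (· ≤ ·) ((B i : Finset V) : Set V)) ∧
        (∀ i, (B i).Nonempty) ∧
        (∀ i j, i ≠ j → Disjoint (B i) (B j)) ∧
        Finset.univ.biUnion B = Finset.univ ∧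
        n = ∑ i, min (B i).card k} ∧
    (∑ D ∈ (Finset.univ.image A ∪
        (Finset.univ \ Finset.univ.biUnion A).image (fun v => ({v} : Finset V))),
      min D.card k) =
      sSup {n : ℕ | ∃ C : Fin k → Finset V,
        (∀ i, IsChain (· ≤ ·) ((C i : Finset V) : Set V)) ∧
        (∀ i j, i ≠ j → Disjoint (C i) (C j)) ∧
        n = (Finset.univ.biUnion C).card} := by
  classical
  have hcard := le_card_of_minimal_family A hA hAdisj hmin
  have hne : ∀ i, (A i).Nonempty := fun i => Finset.card_pos.1 (hk.trans_le (hcard i))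
  have hinj : Function.Injective A := fun i j hij => by
    by_contra h
    have := hAdisj i j h
    rw [hij, disjoint_self] at this
    exact (hne j).ne_empty this
  set U := Finset.univ \ Finset.univ.biUnion A with hU
  have hUA : ∀ v ∈ U, ∀ i, v ∉ A i := fun v hv i hi => by
    simp only [hU, Finset.mem_sdiff, Finset.mem_biUnion, Finset.mem_univ, true_and] at hv
    exact hv ⟨i, hi⟩
  have hUA' : ∀ v, v ∈ U ∨ ∃ i, v ∈ A i := fun v => by
    simp only [hU, Finset.mem_sdiff, Finset.mem_biUnion, Finset.mem_univ, true_and]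
    tauto
  have hmem : ∀ D, D ∈ Finset.univ.image A ∪ U.image (fun v => ({v} : Finset V)) ↔
      (∃ i, A i = D) ∨ ∃ v ∈ U, {v} = D := by
    simp
  have hsum : ∑ D ∈ Finset.univ.image A ∪ U.image (fun v => ({v} : Finset V)), min D.card k =
      U.card + k * m := by
    rw [Finset.sum_union, Finset.sum_image hinj.injOn,
      Finset.sum_image Finset.singleton_injective.injOn,
      Finset.sum_congr rfl fun i _ => min_eq_right (hcard i)]
    · simp [min_eq_left (Nat.succ_le_of_lt hk), add_comm, mul_comm]
    · rw [Finset.disjoint_left]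
      simp only [Finset.mem_image, Finset.mem_univ, true_and]
      rintro _ ⟨i, rfl⟩ ⟨v, hv, h⟩
      exact hUA v hv i (h ▸ Finset.mem_singleton_self v)
  have hanti : ∀ D ∈ Finset.univ.image A ∪ U.image (fun v => ({v} : Finset V)),
      IsAntichain (· ≤ ·) (D : Set V) ∧ D.Nonempty := by
    intro D hD
    rcases (hmem D).1 hD with ⟨i, rfl⟩ | ⟨v, -, rfl⟩
    · exact ⟨hA i, hne i⟩
    · simp
  have hpair : (↑(Finset.univ.image A ∪ U.image (fun v => ({v} : Finset V))) :
      Set (Finset V)).Pairwise fun D E => Disjoint D E := by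
    intro D hD E hE hDE
    rcases (hmem D).1 hD with ⟨i, rfl⟩ | ⟨v, hv, rfl⟩ <;>
      rcases (hmem E).1 hE with ⟨j, rfl⟩ | ⟨w, hw, rfl⟩
    · exact hAdisj i j fun h => hDE (h ▸ rfl)
    · exact Finset.disjoint_singleton_right.2 (hUA w hw i)
    · exact Finset.disjoint_singleton_left.2 (hUA v hv j)
    · exact Finset.disjoint_singleton.2 fun h => hDE (h ▸ rfl)
  have hcover : (Finset.univ.image A ∪ U.image (fun v => ({v} : Finset V))).biUnion id =
      Finset.univ := by
    refine Finset.eq_univ_iff_forall.2 fun v => ?_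
    simp only [Finset.mem_biUnion, id]
    rcases hUA' v with h | ⟨i, h⟩
    · exact ⟨{v}, (hmem _).2 (.inr ⟨v, h, rfl⟩), Finset.mem_singleton_self v⟩
    · exact ⟨A i, (hmem _).2 (.inl ⟨i, rfl⟩), h⟩
  refine ⟨hanti, hpair, hcover, ?_, ?_⟩
  · refine (IsLeast.csInf_eq ⟨?_, ?_⟩).symm
    · set P := Finset.univ.image A ∪ U.image (fun v => ({v} : Finset V))
      let e : Fin P.card ≃ P := P.equivFin.symm
      refine ⟨P.card, fun i => (e i).1, fun i => (hanti _ (e i).2).1,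
        fun i => (hanti _ (e i).2).2, fun i j hij => hpair (e i).2 (e j).2 fun h =>
          hij (e.injective (Subtype.ext h)), ?_, ?_⟩
      · rw [← hcover]
        ext v
        simp only [Finset.mem_biUnion, Finset.mem_univ, true_and, id]
        constructor
        · rintro ⟨i, hi⟩
          exact ⟨_, (e i).2, hi⟩
        · rintro ⟨D, hD, hv⟩
          exact ⟨e.symm ⟨D, hD⟩, by simpa using hv⟩
      · rw [e.sum_comp fun D => min D.1.card k]
        exact (Finset.sum_coe_sort P fun D => min D.card k).symm
    · rintro n ⟨m', B, hB, -, hd, hBU, rfl⟩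
      obtain ⟨l, A', hA', hd', h⟩ := exists_family_norm_eq_sum_min k B hB hd hBU
      rw [hsum, ← h]
      exact hmin l A' hA' hd'
  · refine (IsGreatest.csSup_eq ⟨?_, ?_⟩).symm
    · obtain ⟨C, l, A', hC, hCd, hA', hd', h⟩ := exists_chains_antichains_card_le (V := V) hk
      refine ⟨C, hC, hCd, hsum.trans (le_antisymm ?_ (card_biUnion_chains_le C A hC hA))⟩
      exact (hmin l A' hA' hd').trans h
    · rintro n ⟨C, hC, -, rfl⟩
      rw [hsum]
      exact card_biUnion_chains_le C A hC hA
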